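/- Assume that every routable set X ⊆ V of T^h_FG has total profit ∑_{v ∈ X} w_v ≤ 2. Let v ∈ V be a vertex in level j, let ℓ ≥ 1, and set W = {w ∈ V : v ⪯ w and level(w) ≤ j + ℓ − 1}. Then every X ⊆ W that is W-routable satisfies ∑_{w ∈ X} w_w ≤ 2 · 2^{−(h−1)(j−1)}. -/

import Mathlib

open Finset

/-- The vertex/request set of the Friggstad–Gao instance `T^h_FG`: sequences over
`{1,…,2^{h-1}}` of length at most `h-1`, encoded as a pair of a length `< h`
together with a tuple of that length. -/
abbrev FGV (h : ℕ) : Type := Σ k : Fin h, (Fin (k : ℕ) → Fin (2 ^ (h - 1)))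

/-- The level of a vertex: its length plus one. -/
def FGlevel {h : ℕ} (v : FGV h) : ℕ := (v.1 : ℕ) + 1

/-- The prefix order `v ⪯ w` on sequences. -/
def FGprefix {h : ℕ} (v w : FGV h) : Prop :=
  (v.1 : ℕ) ≤ (w.1 : ℕ) ∧
    ∀ i : Fin (v.1 : ℕ), ∀ j : Fin (w.1 : ℕ), (i : ℕ) = (j : ℕ) → w.2 j = v.2 i

instance {h : ℕ} (v w : FGV h) : Decidable (FGprefix v w) := by
  unfold FGprefix; infer_instance

/-- The demand of a level-`ℓ` request: `2^{h(h-ℓ+1)} - 2^{h(h-ℓ)}`. -/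
def FGdemand {h : ℕ} (v : FGV h) : ℝ :=
  2 ^ (h * (h - FGlevel v + 1)) - 2 ^ (h * (h - FGlevel v))

/-- The capacity of the parent edge `e_v` of a level-`ℓ` vertex: `2^{h(h-ℓ+1)}`. -/
def FGcap {h : ℕ} (v : FGV h) : ℝ := 2 ^ (h * (h - FGlevel v + 1))

/-- The profit of a level-`ℓ` request: `2^{-(h-1)(ℓ-1)}`. -/
noncomputable def FGprofit {h : ℕ} (v : FGV h) : ℝ :=
  (2 : ℝ) ^ (-(((h - 1) * (FGlevel v - 1) : ℕ) : ℤ))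

/-- `X` is routable on the edge `e_v`. -/
def RoutableOn {h : ℕ} (X : Finset (FGV h)) (v : FGV h) : Prop :=
  ∑ w ∈ X.filter (fun w => FGprefix v w), FGdemand w ≤ FGcap v

/-- `X` is `S`-routable. -/
def SRoutable {h : ℕ} (X S : Finset (FGV h)) : Prop :=
  ∀ v ∈ S, RoutableOn X v

/-- `X` is routable. -/
def Routable {h : ℕ} (X : Finset (FGV h)) : Prop :=
  ∀ v : FGV h, RoutableOn X v

/-- `K_I(S)` for the Friggstad–Gao instance: the convex hull of indicator
vectors of `S`-routable sets. -/
def FGKI {h : ℕ} (S : Finset (FGV h)) : Set (FGV h → ℝ) :=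
  convexHull ℝ
    {x | ∃ X : Finset (FGV h), SRoutable X S ∧ x = fun w => if w ∈ X then (1 : ℝ) else 0}

/-- `P^t` for the Friggstad–Gao instance. -/
def FGP (h t : ℕ) : Set (FGV h → ℝ) :=
  ⋂ S ∈ {S : Finset (FGV h) | S.card = t}, FGKI S

lemma FGlevel_le {h : ℕ} (v : FGV h) : FGlevel v ≤ h := v.1.isLt

lemma FGprefix_refl {h : ℕ} (v : FGV h) : FGprefix v v := by
  refine ⟨le_rfl, fun i j hij => ?_⟩
  rw [Fin.ext hij]

lemma FGprefix_antisymm {h : ℕ} {v w : FGV h} (hvw : FGprefix v w) (hwv : FGprefix w v) :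
    v = w := by
  obtain ⟨⟨a, ha⟩, f⟩ := v
  obtain ⟨⟨b, hb⟩, g⟩ := w
  obtain rfl : a = b := le_antisymm hvw.1 hwv.1
  obtain rfl : f = g := funext fun i => hwv.2 i i rfl
  rfl

/-- Delete the first `|v|` entries of `w`. -/
def FGstrip {h : ℕ} (v w : FGV h) : FGV h :=
  ⟨⟨(w.1 : ℕ) - v.1, (Nat.sub_le _ _).trans_lt w.1.isLt⟩,
    fun i => w.2 ⟨v.1 + i, by have := i.isLt; simp only at this; omega⟩⟩

/-- The concatenation of `v` and `p`. -/
def FGappend {h : ℕ} (v p : FGV h) (hlen : (v.1 : ℕ) + p.1 < h) : FGV h :=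
  ⟨⟨v.1 + p.1, hlen⟩, fun i =>
    if hi : (i : ℕ) < v.1 then v.2 ⟨i, hi⟩
    else p.2 ⟨i - v.1, by have := i.isLt; simp only at this; omega⟩⟩

lemma FGprefix_append {h : ℕ} (v p : FGV h) (hlen : (v.1 : ℕ) + p.1 < h) :
    FGprefix v (FGappend v p hlen) := by
  refine ⟨Nat.le_add_right _ _, fun i j hij => ?_⟩
  have hj : (j : ℕ) < v.1 := hij ▸ i.isLt
  simp only [FGappend, hj, dite_true]
  exact congrArg v.2 (Fin.ext hij.symm)

lemma FGappend_prefix {h : ℕ} {v p w : FGV h} (hlen : (v.1 : ℕ) + p.1 < h)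
    (hv : FGprefix v w) (hp : FGprefix p (FGstrip v w)) :
    FGprefix (FGappend v p hlen) w := by
  have hvw := hv.1
  have hpw : (p.1 : ℕ) ≤ w.1 - v.1 := hp.1
  refine ⟨show (v.1 : ℕ) + p.1 ≤ w.1 by omega, fun i j hij => ?_⟩
  have hi : (i : ℕ) < v.1 + p.1 := i.isLt
  by_cases h1 : (i : ℕ) < v.1
  · simp only [FGappend, h1, dite_true]
    exact hv.2 _ _ hij
  · simp only [FGappend, h1, dite_false]
    rw [← hp.2 ⟨i - v.1, by omega⟩ ⟨i - v.1, show (i : ℕ) - v.1 < w.1 - v.1 by omega⟩ rfl]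
    exact congrArg w.2 (Fin.ext (show (j : ℕ) = v.1 + (i - v.1) by omega))

lemma FGprefix_of_strip_eq {h : ℕ} {v w w' : FGV h} (hv : FGprefix v w) (hv' : FGprefix v w')
    (heq : FGstrip v w = FGstrip v w') : FGprefix w w' := by
  have hs : FGprefix (FGstrip v w) (FGstrip v w') := heq ▸ FGprefix_refl _
  have hvw := hv.1
  have hvw' := hv'.1
  have hle : (w.1 : ℕ) - v.1 ≤ w'.1 - v.1 := hs.1
  refine ⟨by omega, fun i j hij => ?_⟩
  by_cases h1 : (i : ℕ) < v.1
  · rw [hv.2 ⟨i, h1⟩ i rfl, hv'.2 ⟨i, h1⟩ j hij]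
  · have := hs.2 ⟨i - v.1, show (i : ℕ) - v.1 < w.1 - v.1 by omega⟩
      ⟨j - v.1, show (j : ℕ) - v.1 < w'.1 - v.1 by omega⟩ (by simp only; omega)
    simp only [FGstrip] at this
    convert this using 2 <;> apply Fin.ext <;> simp only <;> omega

lemma FGstrip_injOn {h : ℕ} (v : FGV h) :
    Set.InjOn (FGstrip v) {w | FGprefix v w} := fun _ hw _ hw' heq =>
  FGprefix_antisymm (FGprefix_of_strip_eq hw hw' heq) (FGprefix_of_strip_eq hw' hw heq.symm)

lemma FGlevel_strip {h : ℕ} {v w : FGV h} (hv : FGprefix v w) :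
    FGlevel w = v.1 + FGlevel (FGstrip v w) := by
  have hvw := hv.1
  simp only [FGlevel, FGstrip]
  omega

lemma FGlevel_append {h : ℕ} (v p : FGV h) (hlen : (v.1 : ℕ) + p.1 < h) :
    FGlevel (FGappend v p hlen) = v.1 + FGlevel p := rfl

lemma FGdemand_nonneg {h : ℕ} (v : FGV h) : 0 ≤ FGdemand v :=
  sub_nonneg.2 <| pow_le_pow_right₀ one_le_two <| Nat.mul_le_mul_left _ (Nat.le_succ _)

lemma FGdemand_of_level_eq {h k : ℕ} {v w : FGV h} (hl : FGlevel w = k + FGlevel v) :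
    FGdemand v = 2 ^ (h * k) * FGdemand w := by
  have hw := FGlevel_le w
  have h1 : h - FGlevel v = k + (h - FGlevel w) := by omega
  simp only [FGdemand, h1]
  ring

lemma FGcap_of_level_eq {h k : ℕ} {v w : FGV h} (hl : FGlevel w = k + FGlevel v) :
    FGcap v = 2 ^ (h * k) * FGcap w := by
  have hw := FGlevel_le w
  have h1 : h - FGlevel v = k + (h - FGlevel w) := by omega
  simp only [FGcap, h1]
  ring

lemma FGprofit_of_level_eq {h k : ℕ} {v w : FGV h} (hl : FGlevel w = k + FGlevel v) :
    FGprofit w = FGprofit v * (2 : ℝ) ^ (-(((h - 1) * k : ℕ) : ℤ)) := by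
  have hv : 1 ≤ FGlevel v := Nat.le_add_left _ _
  have h1 : FGlevel w - 1 = (FGlevel v - 1) + k := by omega
  rw [FGprofit, FGprofit, h1, ← zpow_add₀ two_ne_zero]
  congr 1
  push_cast
  ring

/-- Deleting a common prefix `v` turns a set that is routable on the edges of the subtree at `v`
lying above its elements into a routable set. -/
lemma Routable_image_strip {h : ℕ} {v : FGV h} {X : Finset (FGV h)}
    (hX : ∀ w ∈ X, FGprefix v w)
    (hrout : ∀ u, FGprefix v u → ∀ x ∈ X, FGprefix u x → RoutableOn X u) :
    Routable (X.image (FGstrip v)) := by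
  intro p
  have hinj : Set.InjOn (FGstrip v) ↑(X.filter fun w => FGprefix p (FGstrip v w)) :=
    (FGstrip_injOn v).mono fun w hw => hX w (mem_filter.1 hw).1
  rw [RoutableOn, filter_image, sum_image hinj]
  obtain hempty | ⟨x, hx⟩ := (X.filter fun w => FGprefix p (FGstrip v w)).eq_empty_or_nonempty
  · rw [hempty, sum_empty, FGcap]
    positivity
  obtain ⟨hxX, hpx⟩ := mem_filter.1 hx
  have hlen : (v.1 : ℕ) + p.1 < h := by
    have h1 : (p.1 : ℕ) ≤ x.1 - v.1 := hpx.1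
    have h2 := (hX x hxX).1
    have h3 := x.1.isLt
    omega
  have hu := hrout _ (FGprefix_append v p hlen) x hxX (FGappend_prefix hlen (hX x hxX) hpx)
  rw [FGcap_of_level_eq (FGlevel_append v p hlen)]
  calc ∑ w ∈ X with FGprefix p (FGstrip v w), FGdemand (FGstrip v w)
      = 2 ^ (h * (v.1 : ℕ)) * ∑ w ∈ X with FGprefix p (FGstrip v w), FGdemand w := by
        rw [mul_sum]
        exact sum_congr rfl fun w hw =>
          FGdemand_of_level_eq (FGlevel_strip (hX w (mem_filter.1 hw).1))
    _ ≤ 2 ^ (h * (v.1 : ℕ)) * ∑ w ∈ X with FGprefix (FGappend v p hlen) w, FGdemand w := by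
        refine mul_le_mul_of_nonneg_left ?_ (by positivity)
        refine sum_le_sum_of_subset_of_nonneg (fun w hw => ?_) fun w _ _ => FGdemand_nonneg w
        obtain ⟨hwX, hpw⟩ := mem_filter.1 hw
        exact mem_filter.2 ⟨hwX, FGappend_prefix hlen (hX w hwX) hpw⟩
    _ ≤ _ := by
        gcongr
        exact hu

theorem subtree_profit_bound (h : ℕ) (hh : 2 ≤ h)
    (hrout : ∀ X : Finset (FGV h), Routable X → ∑ w ∈ X, FGprofit w ≤ 2)
    (v : FGV h) (ℓ : ℕ) (hℓ : 1 ≤ ℓ) :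
    ∀ X ⊆ Finset.univ.filter
        (fun w : FGV h => FGprefix v w ∧ FGlevel w ≤ FGlevel v + ℓ - 1),
      SRoutable X (Finset.univ.filter
        (fun w : FGV h => FGprefix v w ∧ FGlevel w ≤ FGlevel v + ℓ - 1)) →
      ∑ w ∈ X, FGprofit w ≤ 2 * (2 : ℝ) ^ (-(((h - 1) * (FGlevel v - 1) : ℕ) : ℤ)) := by
  intro X hXW hXr
  have hX : ∀ w ∈ X, FGprefix v w := fun w hw => (mem_filter.1 (hXW hw)).2.1
  have hrX : Routable (X.image (FGstrip v)) := by
    refine Routable_image_strip hX fun u hvu x hx hux => hXr u (mem_filter.2 ⟨mem_univ _, hvu, ?_⟩)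
    exact (Nat.succ_le_succ hux.1).trans (mem_filter.1 (hXW hx)).2.2
  have hsum := hrout _ hrX
  rw [sum_image ((FGstrip_injOn v).mono hX)] at hsum
  calc ∑ w ∈ X, FGprofit w
      = (∑ w ∈ X, FGprofit (FGstrip v w)) * (2 : ℝ) ^ (-(((h - 1) * (FGlevel v - 1) : ℕ) : ℤ)) := by
        rw [sum_mul]
        exact sum_congr rfl fun w hw => FGprofit_of_level_eq (FGlevel_strip (hX w hw))
    _ ≤ _ := by gcongr
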